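/- Let G be a δ-hyperbolic group, A an infinite ε-quasiconvex subset of G, g ∈ G, and let κ = min{|a|_G : a ∈ A}. If the intersection A ∩ gAg⁻¹ is infinite (where gAg⁻¹ = {gag⁻¹ : a ∈ A}), then there exists an element r ∈ G with |r|_G ≤ 4δ + 2ε + 2κ such that g ∈ ArA⁻¹, i.e. g = a·r·b⁻¹ for some a, b ∈ A. -/

import Mathlib

open Pointwise

section WordMetric

variable {G : Type*} [Group G]

/-- The word length of `g` with respect to a generating set `S`: the length of a shortest
word in the letters of `S` representing `g`. -/
noncomputable def wordLength (S : Set G) (g : G) : ℕ :=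
  sInf {n | ∃ l : List G, (∀ s ∈ l, s ∈ S) ∧ l.prod = g ∧ l.length = n}

/-- The word metric `d(x, y) = |x⁻¹ y|` associated with the generating set `S`,
viewed as a real number. -/
noncomputable def wdist (S : Set G) (x y : G) : ℝ :=
  (wordLength S (x⁻¹ * y) : ℝ)

/-- The Gromov product `(x|y)_w = ½ (d(x,w) + d(y,w) − d(x,y))`. -/
noncomputable def gromovProd (S : Set G) (x y w : G) : ℝ :=
  (wdist S x w + wdist S y w - wdist S x y) / 2

/-- `z` lies between `x` and `y`: `d(x,z) + d(z,y) = d(x,y)`. -/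
def LiesBetween (S : Set G) (x z y : G) : Prop :=
  wdist S x z + wdist S z y = wdist S x y

/-- `G` is `δ`-hyperbolic with respect to the word metric of `S`:
(i) the Gromov products satisfy the `δ`-inequality; (ii) triangles are `δ`-thin;
(iii) triangles are `δ`-slim. -/
def IsHyperbolicWith (S : Set G) (δ : ℝ) : Prop :=
  (∀ x y z w : G,
      gromovProd S x y w ≥ min (gromovProd S x z w) (gromovProd S y z w) - δ) ∧
  (∀ x y z p q : G, LiesBetween S x p y → LiesBetween S x q z →
      wdist S x p = wdist S x q → wdist S x p ≤ gromovProd S y z x →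
      wdist S p q ≤ δ) ∧
  (∀ x y z p : G, LiesBetween S x p y →
      ∃ q : G, (LiesBetween S x q z ∨ LiesBetween S z q y) ∧ wdist S p q ≤ δ)

/-- A subset `Q ⊆ G` is `ε`-quasiconvex: every point between two points of `Q`
is at distance at most `ε` from `Q`. -/
def IsEpsQuasiconvex (S : Set G) (ε : ℝ) (Q : Set G) : Prop :=
  ∀ x ∈ Q, ∀ y ∈ Q, ∀ z : G, LiesBetween S x z y → ∃ q ∈ Q, wdist S z q ≤ ε

/-- A subset `Q ⊆ G` is quasiconvex if it is `ε`-quasiconvex for some `ε ≥ 0`. -/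
def IsQuasiconvex (S : Set G) (Q : Set G) : Prop :=
  ∃ ε : ℝ, 0 ≤ ε ∧ IsEpsQuasiconvex S ε Q

/-- For subsets `B A` of a group `G`, `Prec B A` means `B ⪯ A`: there exist finitely many
elements `x₁, …, xₙ ∈ G` with `B ⊆ A x₁ ∪ ⋯ ∪ A xₙ`. -/
def Prec (B A : Set G) : Prop :=
  ∃ T : Finset G, B ⊆ A * (T : Set G)

/-- `A ≈ B` : `A ⪯ B` and `B ⪯ A`. -/
def Approx (A B : Set G) : Prop :=
  Prec A B ∧ Prec B A

/-- A subset `A` is quasidense if `G ⪯ A`. -/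
def Quasidense (A : Set G) : Prop :=
  Prec (Set.univ : Set G) A

/-- The conjugate subgroup `gHg⁻¹`. -/
def conjSubgroup (g : G) (H : Subgroup G) : Subgroup G :=
  H.map (MulAut.conj g).toMonoidHom

/-- `H^G = {g h g⁻¹ : h ∈ H, g ∈ G}`, the union of all conjugates of `H`. -/
def conjUnion (H : Subgroup G) : Set G :=
  {x | ∃ g : G, ∃ h ∈ H, x = g * h * g⁻¹}

/-- The quasiconvex product `f₀ G₁ f₁ G₂ ⋯ f_{n−1} G_n f_n` determined by the subgroups
`H 0, …, H (n-1)` and the elements `f 0, …, f n`. -/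
def quasiconvexProduct (n : ℕ) (f : Fin (n + 1) → G) (H : Fin n → Subgroup G) : Set G :=
  {x | ∃ g : Fin n → G, (∀ i, g i ∈ H i) ∧
        x = f 0 * (List.ofFn fun i : Fin n => g i * f i.succ).prod}

end WordMetric

section WordMetricBasics

variable {G : Type*} [Group G] {S : Set G}

theorem wordLength_prod_le (l : List G) (hl : ∀ s ∈ l, s ∈ S) :
    wordLength S l.prod ≤ l.length :=
  Nat.sInf_le ⟨l, hl, rfl, rfl⟩

theorem exists_list_length_eq_wordLength (hsym : ∀ s ∈ S, s⁻¹ ∈ S)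
    (hgen : Subgroup.closure S = ⊤) (g : G) :
    ∃ l : List G, (∀ s ∈ l, s ∈ S) ∧ l.prod = g ∧ l.length = wordLength S g := by
  have hne : {n | ∃ l : List G, (∀ s ∈ l, s ∈ S) ∧ l.prod = g ∧ l.length = n}.Nonempty := by
    have hg : g ∈ (Subgroup.closure S).toSubmonoid := by simp [hgen]
    rw [Subgroup.closure_toSubmonoid] at hg
    obtain ⟨l, hl, hprod⟩ := Submonoid.exists_list_of_mem_closure hg
    refine ⟨l.length, l, fun s hs => ?_, hprod, rfl⟩
    rcases hl s hs with h | h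
    · exact h
    · simpa using hsym _ h
  exact Nat.sInf_mem hne

theorem wordLength_mul_le (hsym : ∀ s ∈ S, s⁻¹ ∈ S) (hgen : Subgroup.closure S = ⊤)
    (g h : G) : wordLength S (g * h) ≤ wordLength S g + wordLength S h := by
  obtain ⟨l, hl, hlp, hln⟩ := exists_list_length_eq_wordLength hsym hgen g
  obtain ⟨m, hm, hmp, hmn⟩ := exists_list_length_eq_wordLength hsym hgen h
  have := wordLength_prod_le (l ++ m) fun s hs => (List.mem_append.1 hs).elim (hl s) (hm s)
  rwa [List.prod_append, List.length_append, hlp, hmp, hln, hmn] at this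

theorem wordLength_inv_le (hsym : ∀ s ∈ S, s⁻¹ ∈ S) (hgen : Subgroup.closure S = ⊤)
    (g : G) : wordLength S g⁻¹ ≤ wordLength S g := by
  obtain ⟨l, hl, hlp, hln⟩ := exists_list_length_eq_wordLength hsym hgen g
  have := wordLength_prod_le (S := S) (l.map (·⁻¹)).reverse (by
    simp only [List.mem_reverse, List.mem_map]
    rintro _ ⟨t, ht, rfl⟩
    exact hsym t (hl t ht))
  rwa [← List.prod_inv_reverse, List.length_reverse, List.length_map, hlp, hln] at this

theorem finite_setOf_wordLength_le (hfin : S.Finite) (hsym : ∀ s ∈ S, s⁻¹ ∈ S)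
    (hgen : Subgroup.closure S = ⊤) (n : ℕ) : {g : G | wordLength S g ≤ n}.Finite := by
  have : Finite S := hfin
  refine ((List.finite_length_le S n).image fun l => (l.map Subtype.val).prod).subset ?_
  intro g hg
  obtain ⟨l, hl, hlp, hln⟩ := exists_list_length_eq_wordLength hsym hgen g
  refine ⟨l.attachWith _ hl, ?_, ?_⟩
  · simpa [hln] using hg
  · simpa using hlp

theorem wdist_nonneg (x y : G) : 0 ≤ wdist S x y :=
  Nat.cast_nonneg _

theorem wdist_mul_left (g x y : G) : wdist S (g * x) (g * y) = wdist S x y := by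
  simp [wdist, mul_assoc]

theorem wdist_triangle (hsym : ∀ s ∈ S, s⁻¹ ∈ S) (hgen : Subgroup.closure S = ⊤)
    (x y z : G) : wdist S x z ≤ wdist S x y + wdist S y z := by
  have := wordLength_mul_le hsym hgen (x⁻¹ * y) (y⁻¹ * z)
  rw [mul_assoc, mul_inv_cancel_left] at this
  simp only [wdist]
  exact_mod_cast this

theorem wdist_comm (hsym : ∀ s ∈ S, s⁻¹ ∈ S) (hgen : Subgroup.closure S = ⊤)
    (x y : G) : wdist S x y = wdist S y x := by
  have key (u v : G) : wdist S u v ≤ wdist S v u := by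
    have := wordLength_inv_le hsym hgen (v⁻¹ * u)
    rw [mul_inv_rev, inv_inv] at this
    simp only [wdist]
    exact_mod_cast this
  exact le_antisymm (key x y) (key y x)

theorem exists_liesBetween_wdist_eq (hsym : ∀ s ∈ S, s⁻¹ ∈ S)
    (hgen : Subgroup.closure S = ⊤) {x y : G} {n : ℕ} (hn : (n : ℝ) ≤ wdist S x y) :
    ∃ p, LiesBetween S x p y ∧ wdist S x p = n := by
  have hn' : n ≤ wordLength S (x⁻¹ * y) := by
    simp only [wdist] at hn
    exact_mod_cast hn
  obtain ⟨l, hl, hlp, hln⟩ := exists_list_length_eq_wordLength hsym hgen (x⁻¹ * y)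
  have hsplit : (l.take n).prod * (l.drop n).prod = x⁻¹ * y := by
    rw [List.prod_take_mul_prod_drop, hlp]
  have htake := wordLength_prod_le (l.take n) fun s hs => hl s (List.mem_of_mem_take hs)
  have hdrop := wordLength_prod_le (l.drop n) fun s hs => hl s (List.mem_of_mem_drop hs)
  have hmul := wordLength_mul_le hsym hgen (l.take n).prod (l.drop n).prod
  rw [List.length_take] at htake
  rw [List.length_drop] at hdrop
  rw [hsplit] at hmul
  have hright : (x * (l.take n).prod)⁻¹ * y = (l.drop n).prod := by
    rw [mul_inv_rev, mul_assoc, ← hsplit, inv_mul_cancel_left]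
  refine ⟨x * (l.take n).prod, ?_, ?_⟩
  · simp only [LiesBetween, wdist, hright, inv_mul_cancel_left]
    norm_cast
    omega
  · simp only [wdist, inv_mul_cancel_left]
    norm_cast
    omega

theorem Set.Infinite.exists_lt_wdist (hfin : S.Finite) (hsym : ∀ s ∈ S, s⁻¹ ∈ S)
    (hgen : Subgroup.closure S = ⊤) {B : Set G} (hB : B.Infinite) (x : G) (M : ℝ) :
    ∃ y ∈ B, M < wdist S x y := by
  by_contra! h
  refine hB (((finite_setOf_wordLength_le hfin hsym hgen ⌊M⌋₊).image (x * ·)).subset ?_)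
  exact fun y hy => ⟨x⁻¹ * y, Nat.le_floor (h y hy), by simp⟩

/-- In a geodesic quadrilateral, a point of the side `[w, x]` which is far from `w` and `x`
compared with the adjacent sides is `2δ`-close to the opposite side `[z, y]`. -/
theorem IsHyperbolicWith.exists_liesBetween_opposite {δ : ℝ} (hhyp : IsHyperbolicWith S δ)
    (hsym : ∀ s ∈ S, s⁻¹ ∈ S) (hgen : Subgroup.closure S = ⊤) {w x y z p : G}
    (hp : LiesBetween S w p x) (hw : 2 * δ + wdist S w z < wdist S w p)
    (hx : δ + wdist S y x < wdist S p x) :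
    ∃ q, LiesBetween S z q y ∧ wdist S p q ≤ 2 * δ := by
  have tri := wdist_triangle hsym hgen
  obtain ⟨q, hq | hq, hpq⟩ := hhyp.2.2 w x y p hp
  · obtain ⟨u, hu | hu, hqu⟩ := hhyp.2.2 w y z q hq
    · exfalso
      simp only [LiesBetween] at hu
      linarith [tri w u p, tri u q p, wdist_comm hsym hgen u q, wdist_comm hsym hgen q p,
        wdist_nonneg (S := S) u z]
    · exact ⟨u, hu, by linarith [tri p q u]⟩
  · exfalso
    simp only [LiesBetween] at hq
    linarith [tri p q x, wdist_nonneg (S := S) y q]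

end WordMetricBasics

/-- Let `G` be `δ`-hyperbolic, `A` an infinite `ε`-quasiconvex subset of `G`, `g ∈ G`, and
let `κ = min {|a|_G : a ∈ A}`.  If `A ∩ gAg⁻¹` is infinite, then there is `r ∈ G` with
`|r|_G ≤ 4δ + 2ε + 2κ` such that `g = a * r * b⁻¹` for some `a, b ∈ A`. -/
theorem conj_intersection_infinite_implies_short_middle
    {G : Type*} [Group G] (S : Set G) (hSfin : S.Finite)
    (hSsym : ∀ s ∈ S, s⁻¹ ∈ S) (hSgen : Subgroup.closure S = ⊤)
    (δ : ℝ) (hδ : 0 ≤ δ) (hhyp : IsHyperbolicWith S δ)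
    (A : Set G) (hAinf : A.Infinite)
    (ε : ℝ) (hε : 0 ≤ ε) (hA : IsEpsQuasiconvex S ε A)
    (κ : ℝ) (hκ : IsLeast ((fun a => wdist S 1 a) '' A) κ)
    (g : G) (hint : (A ∩ (fun a => g * a * g⁻¹) '' A).Infinite) :
    ∃ r : G, wdist S 1 r ≤ 4 * δ + 2 * ε + 2 * κ ∧
      ∃ a ∈ A, ∃ b ∈ A, g = a * r * b⁻¹ := by
  obtain ⟨⟨a₀, ha₀, rfl⟩, -⟩ := hκ
  have tri := wdist_triangle hSsym hSgen
  obtain ⟨n, hn⟩ := exists_nat_gt (2 * δ + wdist S a₀ (g * a₀))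
  obtain ⟨x, ⟨hxA, a, ha, rfl⟩, hx⟩ :=
    hint.exists_lt_wdist hSfin hSsym hSgen a₀ (n + (δ + wdist S 1 g⁻¹))
  simp only at hxA hx
  have hside : wdist S (g * a) (g * a * g⁻¹) = wdist S 1 g⁻¹ := by
    simpa using wdist_mul_left (S := S) (g * a) 1 g⁻¹
  obtain ⟨p, hp, hpn⟩ := exists_liesBetween_wdist_eq hSsym hSgen
    (show (n : ℝ) ≤ wdist S a₀ (g * a * g⁻¹) by linarith [wdist_nonneg (S := S) 1 g⁻¹])
  obtain ⟨q, hq, hpq⟩ := hhyp.exists_liesBetween_opposite hSsym hSgen (y := g * a)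
    (z := g * a₀) hp (by rwa [hpn]) (by simp only [LiesBetween] at hp; linarith)
  obtain ⟨b, hb, hpb⟩ := hA a₀ ha₀ _ hxA p hp
  have hq' : LiesBetween S a₀ (g⁻¹ * q) a := by
    have h₁ := wdist_mul_left (S := S) g a₀ (g⁻¹ * q)
    have h₂ := wdist_mul_left (S := S) g (g⁻¹ * q) a
    rw [mul_inv_cancel_left] at h₁ h₂
    simp only [LiesBetween, wdist_mul_left] at hq ⊢
    rw [← h₁, ← h₂, hq]
  obtain ⟨c, hc, hqc⟩ := hA a₀ ha₀ a ha _ hq'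
  rw [← wdist_mul_left g, mul_inv_cancel_left] at hqc
  refine ⟨b⁻¹ * (g * c), ?_, b, hb, c, hc, by group⟩
  have hr : wdist S 1 (b⁻¹ * (g * c)) = wdist S b (g * c) := by simp [wdist]
  rw [hr]
  linarith [tri b p (g * c), tri p q (g * c), wdist_comm hSsym hSgen b p,
    wdist_nonneg (S := S) 1 a₀]
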